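/- Let d ≥ 1 and let T be a measure preserving ℤ^d-action on a σ-finite standard measure space (X, μ). Then the set 𝓡(T) of recurrent directions of T is a G_δ-subset of the projective space P(ℝ^d). -/

import Mathlib

open MeasureTheory Filter Set Topology

noncomputable section

instance {d : ℕ} : TopologicalSpace (Projectivization ℝ (Fin d → ℝ)) :=
  inferInstanceAs (TopologicalSpace (Quotient _))

/-- The coordinatewise cast of an integer vector to a real vector. -/
def zcast {d : ℕ} (γ : Fin d → ℤ) : Fin d → ℝ := fun i => (γ i : ℝ)

/-- `T` is a measure preserving `ℤ^d`-action on `(X, μ)`. -/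
def IsMPAction {d : ℕ} {X : Type*} [MeasurableSpace X] (μ : Measure X)
    (T : (Fin d → ℤ) → X ≃ᵐ X) : Prop :=
  (∀ γ γ' : Fin d → ℤ, ∀ x : X, T (γ + γ') x = T γ (T γ' x)) ∧
    ∀ γ : Fin d → ℤ, MeasurePreserving (T γ) μ μ

/-- The action `T` is free. -/
def IsFreeAction {d : ℕ} {X : Type*} [MeasurableSpace X] (μ : Measure X)
    (T : (Fin d → ℤ) → X ≃ᵐ X) : Prop :=
  ∀ γ : Fin d → ℤ, γ ≠ 0 → ∀ᵐ x ∂μ, T γ x ≠ x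

/-- `T` is recurrent along the line `θ ∈ P(ℝ^d)`. -/
def RecurrentAlong {d : ℕ} {X : Type*} [MeasurableSpace X] (μ : Measure X)
    (T : (Fin d → ℤ) → X ≃ᵐ X) (θ : Projectivization ℝ (Fin d → ℝ)) : Prop :=
  ∀ ε : ℝ, 0 < ε → ∀ A : Set X, MeasurableSet A → 0 < μ A →
    ∃ γ : Fin d → ℤ, γ ≠ 0 ∧ ∃ v ∈ θ.submodule, ‖zcast γ - v‖ < ε ∧ 0 < μ (A ∩ T γ '' A)

/-- The set of recurrent directions `𝓡(T)`. -/
def recSet {d : ℕ} {X : Type*} [MeasurableSpace X] (μ : Measure X)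
    (T : (Fin d → ℤ) → X ≃ᵐ X) : Set (Projectivization ℝ (Fin d → ℝ)) :=
  {θ | RecurrentAlong μ T θ}

/-- `T` is rigid along the line `θ ∈ P(ℝ^d)`. -/
def RigidAlong {d : ℕ} {X : Type*} [MeasurableSpace X] (μ : Measure X)
    (T : (Fin d → ℤ) → X ≃ᵐ X) (θ : Projectivization ℝ (Fin d → ℝ)) : Prop :=
  ∃ γ : ℕ → Fin d → ℤ,
    Tendsto (fun n => ‖zcast (γ n)‖) atTop atTop ∧
    Tendsto (fun n => Metric.infDist (zcast (γ n)) ((θ.submodule : Set (Fin d → ℝ)))) atTop (𝓝 0) ∧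
    ∀ A : Set X, MeasurableSet A → μ A < ⊤ →
      Tendsto (fun n => μ (A ∩ T (γ n) '' A)) atTop (𝓝 (μ A))

/-- The set of rigid directions `𝓡i(T)`. -/
def rigSet {d : ℕ} {X : Type*} [MeasurableSpace X] (μ : Measure X)
    (T : (Fin d → ℤ) → X ≃ᵐ X) : Set (Projectivization ℝ (Fin d → ℝ)) :=
  {θ | RigidAlong μ T θ}

/-- The measure `Leb × μ` on `[0,1)^d × X`. -/
def indMeasure {d : ℕ} {X : Type*} [MeasurableSpace X] (μ : Measure X) :
    Measure ((Fin d → ℝ) × X) :=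
  (Measure.pi fun _ : Fin d => (volume : Measure ℝ).restrict (Set.Ico 0 1)).prod μ

/-- The induced `ℝ^d`-action `T̃_t(y, x) = ({t+y}, T_{[t+y]} x)`. -/
def indMap {d : ℕ} {X : Type*} [MeasurableSpace X] (T : (Fin d → ℤ) → X ≃ᵐ X)
    (t : Fin d → ℝ) : (Fin d → ℝ) × X → (Fin d → ℝ) × X :=
  fun p => (fun i => Int.fract (t i + p.1 i), T (fun i => ⌊t i + p.1 i⌋) p.2)

/-- A one-parameter flow `F` on `(Y, ν)` is conservative. -/
def FlowConservative {Y : Type*} [MeasurableSpace Y] (ν : Measure Y) (F : ℝ → Y → Y) : Prop :=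
  ∀ B : Set Y, MeasurableSet B → 0 < ν B → ∀ K : Set ℝ, IsCompact K →
    ∃ s : ℝ, s ∉ K ∧ 0 < ν (B ∩ F s '' B)

/-- A one-parameter flow `F` on `(Y, ν)` is rigid. -/
def FlowRigid {Y : Type*} [MeasurableSpace Y] (ν : Measure Y) (F : ℝ → Y → Y) : Prop :=
  ∃ s : ℕ → ℝ, Tendsto s atTop atTop ∧
    ∀ B : Set Y, MeasurableSet B → ν B < ⊤ →
      Tendsto (fun n => ν (B ∩ F (s n) '' B)) atTop (𝓝 (ν B))

/-- An `ℝ^d`-action `R` on `(Y, ν)` is recurrent along the line `θ`: the flow along some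
(equivalently, every) nonzero vector of `θ` is conservative. -/
def ActionRecurrentAlong {d : ℕ} {Y : Type*} [MeasurableSpace Y] (ν : Measure Y)
    (R : (Fin d → ℝ) → Y → Y) (θ : Projectivization ℝ (Fin d → ℝ)) : Prop :=
  ∃ v ∈ θ.submodule, v ≠ (0 : Fin d → ℝ) ∧ FlowConservative ν (fun s => R (s • v))

/-- An `ℝ^d`-action `R` on `(Y, ν)` is rigid along the line `θ`. -/
def ActionRigidAlong {d : ℕ} {Y : Type*} [MeasurableSpace Y] (ν : Measure Y)
    (R : (Fin d → ℝ) → Y → Y) (θ : Projectivization ℝ (Fin d → ℝ)) : Prop :=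
  ∃ v ∈ θ.submodule, v ≠ (0 : Fin d → ℝ) ∧ FlowRigid ν (fun s => R (s • v))

/-- The lattice point `γ` lies at distance less than `ε` from the line `θ`. -/
def InStrip {d : ℕ} (θ : Projectivization ℝ (Fin d → ℝ)) (ε : ℝ) (γ : Fin d → ℤ) : Prop :=
  ∃ v ∈ θ.submodule, ‖zcast γ - v‖ < ε

lemma zcast_zero {d : ℕ} : zcast (0 : Fin d → ℤ) = 0 := by
  ext i; simp [zcast]

lemma zcast_add {d : ℕ} (γ γ' : Fin d → ℤ) : zcast (γ + γ') = zcast γ + zcast γ' := by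
  ext i; simp [zcast]

lemma zcast_sub {d : ℕ} (γ γ' : Fin d → ℤ) : zcast (γ - γ') = zcast γ - zcast γ' := by
  ext i; simp [zcast]

namespace InStrip

variable {d : ℕ} {θ : Projectivization ℝ (Fin d → ℝ)} {γ γ' : Fin d → ℤ} {ε ε' : ℝ}

lemma zero (hε : 0 < ε) : InStrip θ ε 0 :=
  ⟨0, θ.submodule.zero_mem, by simpa [zcast_zero] using hε⟩

lemma mono (h : InStrip θ ε γ) (hε : ε ≤ ε') : InStrip θ ε' γ :=
  let ⟨v, hv, hlt⟩ := h
  ⟨v, hv, hlt.trans_le hε⟩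

lemma add (h : InStrip θ ε γ) (h' : InStrip θ ε' γ') : InStrip θ (ε + ε') (γ + γ') := by
  obtain ⟨v, hv, hlt⟩ := h
  obtain ⟨v', hv', hlt'⟩ := h'
  refine ⟨v + v', θ.submodule.add_mem hv hv', ?_⟩
  rw [zcast_add, add_sub_add_comm]
  exact (norm_add_le _ _).trans_lt (add_lt_add hlt hlt')

lemma sub (h : InStrip θ ε γ) (h' : InStrip θ ε' γ') : InStrip θ (ε + ε') (γ - γ') := by
  obtain ⟨v, hv, hlt⟩ := h
  obtain ⟨v', hv', hlt'⟩ := h'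
  refine ⟨v - v', θ.submodule.sub_mem hv hv', ?_⟩
  rw [zcast_sub, sub_sub_sub_comm]
  exact (norm_sub_le _ _).trans_lt (add_lt_add hlt hlt')

end InStrip

lemma isOpen_setOf_inStrip {d : ℕ} (ε : ℝ) (γ : Fin d → ℤ) :
    IsOpen {θ | InStrip θ ε γ} := by
  refine isOpen_coinduced.2 ?_
  have : (Quotient.mk _ ⁻¹' {θ : Projectivization ℝ (Fin d → ℝ) | InStrip θ ε γ} :
      Set {v : Fin d → ℝ // v ≠ 0}) = ⋃ c : ℝ, {w | ‖zcast γ - c • w.1‖ < ε} := by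
    ext w
    change InStrip (Projectivization.mk ℝ w.1 w.2) ε γ ↔ _
    simp [InStrip, Projectivization.submodule_mk, Submodule.mem_span_singleton]
  exact this ▸ isOpen_iUnion fun c => isOpen_lt (by fun_prop) continuous_const

section Action

variable {d : ℕ} {X : Type*} [MeasurableSpace X] {μ : Measure X} {T : (Fin d → ℤ) → X ≃ᵐ X}

lemma IsMPAction.apply_zero (hT : IsMPAction μ T) (x : X) : T 0 x = x :=
  (T 0).injective (by rw [← hT.1, add_zero])

lemma IsMPAction.measure_image (hT : IsMPAction μ T) (γ : Fin d → ℤ) (A : Set X) :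
    μ (T γ '' A) = μ A := by
  rw [← (hT.2 γ).measure_preimage_equiv, preimage_image_eq _ (T γ).injective]

lemma Finset.card_lt_card_union_image_add_right {G : Type*} [AddCommGroup G] [DecidableEq G]
    [IsAddTorsionFree G] {S : Finset G} (hS : S.Nonempty) {g : G} (hg : g ≠ 0) :
    S.card < (S ∪ S.image (· + g)).card := by
  refine Finset.card_lt_card (Finset.subset_union_left.ssubset_of_ne fun h => ?_)
  have hstep : ∀ s ∈ S, s + g ∈ S := fun s hs => by
    rw [h]
    exact Finset.mem_union_right _ (Finset.mem_image_of_mem _ hs)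
  obtain ⟨s, hs⟩ := hS
  have hmem : ∀ n : ℕ, s + n • g ∈ S := fun n => by
    induction n with
    | zero => simpa using hs
    | succ n ih => simpa [succ_nsmul, add_assoc] using hstep _ ih
  refine Set.infinite_of_injective_forall_mem (f := fun n : ℕ => s + n • g) ?_ hmem
    S.finite_toSet
  exact (add_right_injective s).comp
    (injective_nsmul_iff_not_isOfFinAddOrder.2 (not_isOfFinAddOrder_of_isAddTorsionFree hg))

/-- Along a recurrent direction, every set of positive measure returns to itself simultaneously
along arbitrarily many lattice points in any strip around the direction. -/
lemma RecurrentAlong.exists_returns (hT : IsMPAction μ T)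
    {θ : Projectivization ℝ (Fin d → ℝ)} (hθ : RecurrentAlong μ T θ) {A : Set X}
    (hA : MeasurableSet A) (hA0 : 0 < μ A) (n : ℕ) {ε : ℝ} (hε : 0 < ε) :
    ∃ S : Finset (Fin d → ℤ), n < S.card ∧ (∀ γ ∈ S, InStrip θ ε γ) ∧
      ∃ B ⊆ A, MeasurableSet B ∧ 0 < μ B ∧ ∀ γ ∈ S, ∀ x ∈ B, T γ x ∈ A := by
  classical
  induction n generalizing ε with
  | zero =>
    refine ⟨{0}, by simp, by simpa using InStrip.zero hε, A, subset_rfl, hA, hA0, ?_⟩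
    simp [hT.apply_zero]
  | succ n ih =>
    obtain ⟨S, hcard, hS, B, hBA, hB, hB0, hret⟩ := ih (half_pos hε)
    obtain ⟨γ, hγ, v, hv, hlt, hpos⟩ := hθ _ (half_pos hε) B hB hB0
    refine ⟨S ∪ S.image (· + γ), ?_, ?_, B ∩ T γ ⁻¹' B, inter_subset_left.trans hBA,
      hB.inter ((T γ).measurable hB), ?_, ?_⟩
    · exact (Nat.succ_le_of_lt hcard).trans_lt (Finset.card_lt_card_union_image_add_right
        (Finset.card_pos.1 (Nat.zero_lt_of_lt hcard)) hγ)
    · intro s hs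
      rcases Finset.mem_union.1 hs with hs | hs
      · exact (hS s hs).mono (by linarith)
      · obtain ⟨s, hs', rfl⟩ := Finset.mem_image.1 hs
        exact ((hS s hs').add ⟨v, hv, hlt⟩).mono (by linarith)
    · rw [← hT.measure_image γ, image_inter_preimage, inter_comm]
      exact hpos
    · rintro s hs x ⟨hx, hx'⟩
      rcases Finset.mem_union.1 hs with hs | hs
      · exact hret s hs x hx
      · obtain ⟨s, hs', rfl⟩ := Finset.mem_image.1 hs
        rw [hT.1]
        exact hret s hs' _ hx'

/-- If the translates of `A` along `F` are essentially disjoint, the partial orbit sums of `f`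
along `F` have integral over `A` at most that of `f`. -/
lemma IsMPAction.setLIntegral_sum_le (hT : IsMPAction μ T) {f : X → ENNReal}
    (hf : Measurable f) {A : Set X} (hA : MeasurableSet A) {F : Finset (Fin d → ℤ)}
    (hF : ∀ γ ∈ F, ∀ γ' ∈ F, γ ≠ γ' → μ (A ∩ T (γ - γ') '' A) = 0) :
    ∫⁻ x in A, ∑ γ ∈ F, f (T γ x) ∂μ ≤ ∫⁻ x, f x ∂μ := by
  have hdisj : Set.Pairwise (↑F) (Function.onFun (AEDisjoint μ) fun γ => T γ '' A) := by
    intro γ hγ γ' hγ' hne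
    have himage : T γ '' A = T γ' '' (T (γ - γ') '' A) := by
      rw [image_image]
      refine image_congr fun x _ => ?_
      rw [← hT.1, add_sub_cancel]
    change μ (T γ '' A ∩ T γ' '' A) = 0
    rw [himage, ← image_inter (T γ').injective, hT.measure_image, inter_comm]
    exact hF γ hγ γ' hγ' hne
  calc ∫⁻ x in A, ∑ γ ∈ F, f (T γ x) ∂μ
      = ∑ γ ∈ F, ∫⁻ x in A, f (T γ x) ∂μ :=
        lintegral_finsetSum _ fun γ _ => hf.comp (T γ).measurable
    _ = ∑ γ ∈ F, ∫⁻ x in T γ '' A, f x ∂μ := by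
        refine Finset.sum_congr rfl fun γ _ => ?_
        exact (hT.2 γ).setLIntegral_comp_emb (T γ).measurableEmbedding f A
    _ = ∫⁻ x in ⋃ γ ∈ F, T γ '' A, f x ∂μ :=
        (lintegral_biUnion_finset₀ hdisj
          (fun γ _ => ((T γ).measurableSet_image.2 hA).nullMeasurableSet) f).symm
    _ ≤ ∫⁻ x, f x ∂μ := setLIntegral_le_lintegral _ _

/-- Along a recurrent direction, the orbit sums over a strip of a positive function are almost
everywhere infinite; here in terms of finite sums on a set of finite measure. -/
lemma RecurrentAlong.exists_measure_sum_le_lt (hT : IsMPAction μ T)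
    {θ : Projectivization ℝ (Fin d → ℝ)} (hθ : RecurrentAlong μ T θ) {f : X → ENNReal}
    (hf : Measurable f) (hf0 : ∀ x, 0 < f x) {s : Set X} (hs : MeasurableSet s)
    (hsfin : μ s ≠ ⊤) {ε : ℝ} (hε : 0 < ε) {c δ : ENNReal} (hc : c ≠ ⊤) (hδ : 0 < δ) :
    ∃ F : Finset (Fin d → ℤ), (∀ γ ∈ F, InStrip θ ε γ) ∧
      μ (s ∩ {x | ∑ γ ∈ F, f (T γ x) ≤ c}) < δ := by
  classical
  set V : Finset (Fin d → ℤ) → Set X :=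
    fun F => s ∩ {x | ∑ γ ∈ F with InStrip θ ε γ, f (T γ x) ≤ c} with hV
  have hVmeas : ∀ F, MeasurableSet (V F) := fun F => hs.inter <| measurableSet_le
    (Finset.measurable_sum _ fun γ _ => hf.comp (T γ).measurable) measurable_const
  have hVanti : Antitone V := fun F G hFG => inter_subset_inter_right _ fun x (hx : _ ≤ c) =>
    (Finset.sum_le_sum_of_subset (Finset.filter_subset_filter _ hFG)).trans hx
  suffices hnull : μ (⋂ F, V F) = 0 by
    have hinf := hVanti.directed_ge.measure_iInter (μ := μ)
      (fun F => (hVmeas F).nullMeasurableSet)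
      ⟨∅, measure_ne_top_of_subset inter_subset_left hsfin⟩
    obtain ⟨F, hF⟩ := iInf_lt_iff.1 (hinf ▸ hnull ▸ hδ)
    exact ⟨F.filter (InStrip θ ε), fun γ hγ => (Finset.mem_filter.1 hγ).2, hF⟩
  by_contra hne
  have hunion : (⋂ F, V F) ⊆ ⋃ j : ℕ, (⋂ F, V F) ∩ {x | (j : ENNReal)⁻¹ < f x} := by
    intro x hx
    obtain ⟨j, hj⟩ := ENNReal.exists_inv_nat_lt (hf0 x).ne'
    exact mem_iUnion.2 ⟨j, hx, hj⟩
  obtain ⟨j, hj⟩ : ∃ j : ℕ, μ ((⋂ F, V F) ∩ {x | (j : ENNReal)⁻¹ < f x}) ≠ 0 := by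
    by_contra! h
    exact hne (measure_mono_null hunion (measure_iUnion_null h))
  have hAmeas : MeasurableSet ((⋂ F, V F) ∩ {x | (j : ENNReal)⁻¹ < f x}) :=
    (MeasurableSet.iInter hVmeas).inter (measurableSet_lt measurable_const hf)
  obtain ⟨n, hn⟩ := ENNReal.exists_nat_mul_gt (a := (j : ENNReal)⁻¹) (b := c) (by simp) hc
  obtain ⟨S, hcard, hS, B, hBA, -, hB0, hret⟩ :=
    hθ.exists_returns hT hAmeas (pos_iff_ne_zero.2 hj) n hε
  obtain ⟨x, hx⟩ := nonempty_of_measure_ne_zero hB0.ne'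
  have hle : ∑ γ ∈ S, f (T γ x) ≤ c := by
    have := (mem_iInter.1 (hBA hx).1 S).2
    rwa [Set.mem_ofPred_eq, Finset.filter_true_of_mem hS] at this
  have hge : (S.card : ENNReal) * (j : ENNReal)⁻¹ ≤ ∑ γ ∈ S, f (T γ x) := by
    rw [← nsmul_eq_mul]
    exact Finset.card_nsmul_le_sum _ _ _ fun γ hγ => (hret γ hγ x hx).2.le
  refine (hn.trans_le ?_).not_ge (hge.trans hle)
  gcongr

/-- A direction is recurrent if the orbit sums over strips of some integrable function are
almost everywhere infinite; here in terms of finite sums on sets exhausting the space. -/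
lemma recurrentAlong_of_forall_measure_sum_le_lt (hT : IsMPAction μ T)
    {θ : Projectivization ℝ (Fin d → ℝ)} {f : X → ENNReal} (hf : Measurable f)
    (hfint : ∫⁻ x, f x ∂μ < 1) {s : ℕ → Set X} (hs : ⋃ k, s k = univ)
    (h : ∀ k m n : ℕ, ∃ F : Finset (Fin d → ℤ), (∀ γ ∈ F, InStrip θ (1 / (m + 1 : ℝ)) γ) ∧
      μ (s k ∩ {x | ∑ γ ∈ F, f (T γ x) ≤ n}) < (n : ENNReal)⁻¹) :
    RecurrentAlong μ T θ := by
  intro ε hε A hA hA0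
  by_contra! hno
  obtain ⟨k, hk⟩ : ∃ k, μ (A ∩ s k) ≠ 0 := by
    by_contra! h0
    refine hA0.ne' (measure_mono_null ?_ (measure_iUnion_null h0))
    rw [← inter_iUnion, hs, inter_univ]
  obtain ⟨m, hm⟩ := exists_nat_one_div_lt (half_pos hε)
  obtain ⟨n, hn⟩ := ENNReal.exists_inv_nat_lt (ENNReal.half_pos hk).ne'
  obtain ⟨F, hF, hlt⟩ := h k m n
  have hint := hT.setLIntegral_sum_le hf hA (F := F) fun γ hγ γ' hγ' hne => by
    obtain ⟨v, hv, hv'⟩ := ((hF γ hγ).sub (hF γ' hγ')).mono (ε' := ε) (by linarith)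
    exact nonpos_iff_eq_zero.1 (hno _ (sub_ne_zero.2 hne) v hv hv')
  have hmarkov : μ (A ∩ {x | (n : ENNReal) ≤ ∑ γ ∈ F, f (T γ x)}) ≤ (n : ENNReal)⁻¹ := by
    have hmeas : Measurable fun x => ∑ γ ∈ F, f (T γ x) :=
      Finset.measurable_sum _ fun γ _ => hf.comp (T γ).measurable
    have := mul_meas_ge_le_lintegral (μ := μ.restrict A) hmeas n
    rw [Measure.restrict_apply (measurableSet_le measurable_const hmeas), inter_comm] at this
    rw [ENNReal.le_inv_iff_mul_le, mul_comm]
    exact this.trans (hint.trans hfint.le)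
  have hcover : A ∩ s k ⊆ (s k ∩ {x | ∑ γ ∈ F, f (T γ x) ≤ n}) ∪
      (A ∩ {x | (n : ENNReal) ≤ ∑ γ ∈ F, f (T γ x)}) := fun x hx =>
    (le_total (∑ γ ∈ F, f (T γ x)) n).imp (fun h => ⟨hx.2, h⟩) fun h => ⟨hx.1, h⟩
  have hsum : μ (A ∩ s k) < μ (A ∩ s k) / 2 + μ (A ∩ s k) / 2 :=
    calc μ (A ∩ s k) ≤ _ := (measure_mono hcover).trans (measure_union_le _ _)
      _ < _ := ENNReal.add_lt_add (hlt.trans hn) (hmarkov.trans_lt hn)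
  exact hsum.ne (ENNReal.add_halves _).symm

end Action

/-- the set of recurrent directions of a measure preserving `ℤ^d`-action is a
`G_δ`-subset of the projective space `P(ℝ^d)`. -/
theorem recSet_isGδ {X : Type*} [MeasurableSpace X] [StandardBorelSpace X]
    (μ : Measure X) [SigmaFinite μ] {d : ℕ} (hd : 1 ≤ d)
    (T : (Fin d → ℤ) → X ≃ᵐ X) (hT : IsMPAction μ T) :
    IsGδ (recSet μ T) := by
  obtain ⟨g, hg0, hg, hgint⟩ :=
    exists_pos_lintegral_lt_of_sigmaFinite μ (ε := 1) one_ne_zero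
  have heq : recSet μ T = ⋂ (k : ℕ) (m : ℕ) (n : ℕ), ⋃ F ∈ {F : Finset (Fin d → ℤ) |
      μ (spanningSets μ k ∩ {x | ∑ γ ∈ F, (g (T γ x) : ENNReal) ≤ n}) < (n : ENNReal)⁻¹},
      ⋂ γ ∈ F, {θ | InStrip θ (1 / (m + 1 : ℝ)) γ} := by
    ext θ
    simp only [mem_iInter, mem_iUnion, mem_ofPred_eq, exists_prop]
    constructor
    · intro hθ k m n
      obtain ⟨F, hF, hlt⟩ := RecurrentAlong.exists_measure_sum_le_lt hT hθ
        hg.coe_nnreal_ennreal (fun x => ENNReal.coe_pos.2 (hg0 x))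
        (measurableSet_spanningSets μ k) (measure_spanningSets_lt_top μ k).ne
        (Nat.one_div_pos_of_nat (n := m)) (ENNReal.natCast_ne_top n)
        (ENNReal.inv_pos.2 (ENNReal.natCast_ne_top n))
      exact ⟨F, hlt, hF⟩
    · intro h
      refine recurrentAlong_of_forall_measure_sum_le_lt hT hg.coe_nnreal_ennreal hgint
        (iUnion_spanningSets μ) fun k m n => ?_
      obtain ⟨F, hlt, hF⟩ := h k m n
      exact ⟨F, hF, hlt⟩
  rw [heq]
  exact .iInter fun k => .iInter fun m => .iInter fun n => IsOpen.isGδ <|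
    isOpen_biUnion fun F _ => isOpen_biInter_finset fun γ _ => isOpen_setOf_inStrip _ γ
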